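/- arXiv:math/0703080 — 11 statements merged into one kernel-verified Lean document; each statement's English description precedes it below -/
import Mathlib

section
/- Let a > b > 0 be real numbers and r > 0. Set E = (a+b)/2 and suppose E > sqrt(a*b) * e^r. Define kappa = (1 - sqrt(1 - e^{-2r}))/2, u = kappa*a + (1-kappa)*b, and t = u*(E-u)/((a-u)*(u-b)). Then u > 0, t > 0, and the pair (u, t) satisfies the two simultaneous equations sqrt((a*t - u*t + u)*(b*t - u*t + u))/u = e^r and (a-u)/(2*(a*t - u*t + u)) + (b-u)/(2*(b*t - u*t + u)) = 0. -/
/-- Theorem 1.1 (nontrivial case) for the coin-flip game paying `a` or `b`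
each with probability 1/2 at interest rate `r`: if `E = (a+b)/2 > √(ab)·eʳ`,
then `u = κa + (1-κ)b` and `t = u(E-u)/((a-u)(u-b))` with
`κ = (1 - √(1 - e^{-2r}))/2` are positive and solve the two simultaneous
equations characterizing the price and optimal proportion of investment. -/
theorem stmt0 (a b r : ℝ) (hb : 0 < b) (hba : b < a) (hr : 0 < r)
    (E κ u t : ℝ)
    (hE : E = (a + b) / 2)
    (hEbig : E > Real.sqrt (a * b) * Real.exp r)
    (hκ : κ = (1 - Real.sqrt (1 - Real.exp (-(2 * r)))) / 2)
    (hu : u = κ * a + (1 - κ) * b)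
    (ht : t = u * (E - u) / ((a - u) * (u - b))) :
    0 < u ∧ 0 < t ∧
      Real.sqrt ((a * t - u * t + u) * (b * t - u * t + u)) / u = Real.exp r ∧
      (a - u) / (2 * (a * t - u * t + u)) + (b - u) / (2 * (b * t - u * t + u)) = 0 := by
  have hlt : Real.exp (-(2 * r)) < 1 := Real.exp_lt_one_iff.mpr (by linarith)
  have hpos : 0 < Real.exp (-(2 * r)) := Real.exp_pos _
  set s := Real.sqrt (1 - Real.exp (-(2 * r))) with hs
  have hs0 : 0 < s := Real.sqrt_pos.mpr (by linarith)
  have hsq : s ^ 2 = 1 - Real.exp (-(2 * r)) := Real.sq_sqrt (by linarith)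
  have hs1 : s < 1 := by nlinarith
  have hκ0 : 0 < κ := by linarith
  have hκ1 : 0 < 1 - κ := by linarith
  have hab : 0 < a - b := by linarith
  have hub : u - b = κ * (a - b) := by rw [hu]; ring
  have hau : a - u = (1 - κ) * (a - b) := by rw [hu]; ring
  have hEu : E - u = (1 / 2 - κ) * (a - b) := by rw [hu, hE]; ring
  have hu0 : 0 < u := by nlinarith [mul_pos hκ0 hab]
  have ht' : t = u * (1 / 2 - κ) / ((1 - κ) * κ * (a - b)) := by
    rw [ht, hub, hau, hEu]
    field_simp
  have ht0 : 0 < t := by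
    have : 0 < 1 / 2 - κ := by linarith
    rw [ht']
    positivity
  have hA : a * t - u * t + u = u / (2 * κ) := by
    have : a * t - u * t + u = (a - u) * t + u := by ring
    rw [this, hau, ht']
    field_simp
    ring
  have hB : b * t - u * t + u = u / (2 * (1 - κ)) := by
    have : b * t - u * t + u = u - (u - b) * t := by ring
    rw [this, hub, ht']
    field_simp
    ring
  have hprod : Real.exp r ^ 2 * (4 * κ * (1 - κ)) = 1 := by
    have h4 : 4 * κ * (1 - κ) = Real.exp (-(2 * r)) := by
      rw [hκ]
      linear_combination -hsq
    rw [h4, ← Real.exp_nat_mul, ← Real.exp_add]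
    simp
  refine ⟨hu0, ht0, ?_, ?_⟩
  · have hsquare : u / (2 * κ) * (u / (2 * (1 - κ))) = (u * Real.exp r) ^ 2 := by
      field_simp
      linear_combination -hprod
    rw [hA, hB, hsquare, Real.sqrt_sq (by positivity)]
    field_simp
  · have hbu : b - u = -(κ * (a - b)) := by linarith
    rw [hA, hB, hau, hbu]
    field_simp
    ring
end

section
/- Let (X, μ) be a probability space, let c : X → ℝ be measurable with c > 0 almost everywhere and log∘c integrable, let u > 0 and r ∈ ℝ. Suppose there exists t* ∈ [0,1] such that the function φ(t) := ∫ log(c(x)·t/u − t + 1) dμ(x) satisfies φ(t) ≤ φ(t*) for all t ∈ [0,1] and φ(t*) = r. Then exp(∫ log c(x) dμ(x))/e^r ≤ u. -/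
open MeasureTheory

/-- Lemma D.6: if the function `φ(t) = ∫ log(c(x)t/u − t + 1) dμ` attains its
maximum over `[0,1]` at some `t*` with value `r`, then the discounted
geometric mean `exp(∫ log c dμ)/eʳ` is at most `u`. -/
theorem stmt6 {X : Type*} [MeasurableSpace X] (μ : Measure X) [IsProbabilityMeasure μ]
    (c : X → ℝ) (hc_meas : Measurable c) (hc_pos : ∀ᵐ x ∂μ, 0 < c x)
    (hlog : Integrable (fun x => Real.log (c x)) μ)
    (u r : ℝ) (hu : 0 < u)
    (tstar : ℝ) (htstar : tstar ∈ Set.Icc (0 : ℝ) 1)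
    (hmax : ∀ t ∈ Set.Icc (0 : ℝ) 1,
      ∫ x, Real.log (c x * t / u - t + 1) ∂μ ≤
        ∫ x, Real.log (c x * tstar / u - tstar + 1) ∂μ)
    (hval : ∫ x, Real.log (c x * tstar / u - tstar + 1) ∂μ = r) :
    Real.exp (∫ x, Real.log (c x) ∂μ) / Real.exp r ≤ u := by
  have hone : ∫ x, Real.log (c x * 1 / u - 1 + 1) ∂μ
      = ∫ x, Real.log (c x) ∂μ - Real.log u := by
    have hae : (fun x => Real.log (c x * 1 / u - 1 + 1)) =ᵐ[μ]
        fun x => Real.log (c x) - Real.log u := by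
      filter_upwards [hc_pos] with x hx
      rw [mul_one, sub_add_cancel, Real.log_div hx.ne' hu.ne']
    rw [integral_congr_ae hae, integral_sub hlog (integrable_const _)]
    simp
  have hle := hmax 1 (by simp)
  rw [hone, hval] at hle
  rw [← Real.exp_sub, ← Real.le_log_iff_exp_le hu]
  linarith
end

section
/- Let (X, μ) be a probability space, let a, b : X → ℝ be measurable with a > 0 and b > 0 almost everywhere, and suppose log∘a and log∘b are integrable. Let r ∈ ℝ and define f(p) := exp(∫ log(p·a(x) + (1−p)·b(x)) dμ(x))/e^r for p ∈ [0,1]. Then f is concave on [0,1]; that is, λ·f(p) + (1−λ)·f(q) ≤ f(λ·p + (1−λ)·q) for all p, q, λ ∈ [0,1]. -/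
open MeasureTheory

/-- A convex combination of two positive reals is positive. -/
theorem convexComb_pos {a b p : ℝ} (ha : 0 < a) (hb : 0 < b) (hp : p ∈ Set.Icc (0 : ℝ) 1) :
    0 < p * a + (1 - p) * b :=
  convex_Ioi (0 : ℝ) ha hb hp.1 (sub_nonneg.2 hp.2) (add_sub_cancel p 1)

theorem abs_log_convexComb_le {a b p : ℝ} (ha : 0 < a) (hb : 0 < b)
    (hp : p ∈ Set.Icc (0 : ℝ) 1) :
    |Real.log (p * a + (1 - p) * b)| ≤ |Real.log a| + |Real.log b| := by
  obtain ⟨hp0, hp1⟩ := hp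
  have hq : 0 ≤ 1 - p := sub_nonneg.2 hp1
  wlog hab : a ≤ b generalizing a b p
  · have := this hb ha hq (by linarith) (by linarith) (le_of_not_ge hab)
    rwa [sub_sub_cancel, add_comm, add_comm (|Real.log b|)] at this
  have hlow : a ≤ p * a + (1 - p) * b := by nlinarith
  have hupp : p * a + (1 - p) * b ≤ b := by nlinarith
  have h₁ := Real.log_le_log ha hlow
  have h₂ := Real.log_le_log (ha.trans_le hlow) hupp
  rw [abs_le]
  constructor
  · linarith [neg_abs_le (Real.log a), abs_nonneg (Real.log b)]
  · linarith [le_abs_self (Real.log b), abs_nonneg (Real.log a)]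

theorem integrable_log_convexComb {X : Type*} [MeasurableSpace X] {μ : Measure X}
    {a b : X → ℝ} (ha : AEMeasurable a μ) (hb : AEMeasurable b μ)
    (ha_pos : ∀ᵐ x ∂μ, 0 < a x) (hb_pos : ∀ᵐ x ∂μ, 0 < b x)
    (hloga : Integrable (fun x => Real.log (a x)) μ)
    (hlogb : Integrable (fun x => Real.log (b x)) μ) {p : ℝ} (hp : p ∈ Set.Icc (0 : ℝ) 1) :
    Integrable (fun x => Real.log (p * a x + (1 - p) * b x)) μ := by
  refine (hloga.abs.add hlogb.abs).mono'
    (Real.measurable_log.comp_aemeasurable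
      ((ha.const_mul p).add (hb.const_mul (1 - p)))).aestronglyMeasurable ?_
  filter_upwards [ha_pos, hb_pos] with x hax hbx
  exact abs_log_convexComb_le hax hbx hp

/-- The geometric mean `u ↦ exp (∫ log u)` over a probability measure is concave on positive
functions. -/
theorem exp_integral_log_concave {X : Type*} [MeasurableSpace X] {μ : Measure X}
    [IsProbabilityMeasure μ] {u v : X → ℝ}
    (hu_pos : ∀ᵐ x ∂μ, 0 < u x) (hv_pos : ∀ᵐ x ∂μ, 0 < v x)
    (hu : Integrable (fun x => Real.log (u x)) μ) (hv : Integrable (fun x => Real.log (v x)) μ)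
    {c : ℝ} (hc : c ∈ Set.Icc (0 : ℝ) 1)
    (hw : Integrable (fun x => Real.log (c * u x + (1 - c) * v x)) μ) :
    c * Real.exp (∫ x, Real.log (u x) ∂μ) + (1 - c) * Real.exp (∫ x, Real.log (v x) ∂μ) ≤
      Real.exp (∫ x, Real.log (c * u x + (1 - c) * v x) ∂μ) := by
  set U := ∫ x, Real.log (u x) ∂μ with hU
  set V := ∫ x, Real.log (v x) ∂μ with hV
  set M := c * Real.exp U + (1 - c) * Real.exp V with hM
  have hM_pos : 0 < M := convexComb_pos (Real.exp_pos U) (Real.exp_pos V) hc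
  set θ := c * Real.exp U / M with hθ
  set η := (1 - c) * Real.exp V / M with hη
  have hθ_nonneg : 0 ≤ θ := div_nonneg (mul_nonneg hc.1 (Real.exp_pos U).le) hM_pos.le
  have hη_nonneg : 0 ≤ η :=
    div_nonneg (mul_nonneg (sub_nonneg.2 hc.2) (Real.exp_pos V).le) hM_pos.le
  have hsum : θ + η = 1 := by rw [hθ, hη, ← add_div, ← hM, div_self hM_pos.ne']
  have hpt : ∀ᵐ x ∂μ, θ * Real.log (u x) + η * Real.log (v x) +
      (Real.log M - θ * U - η * V) ≤ Real.log (c * u x + (1 - c) * v x) := by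
    filter_upwards [hu_pos, hv_pos] with x hux hvx
    have key := strictConcaveOn_log_Ioi.concaveOn.2
      (show M * u x / Real.exp U ∈ Set.Ioi 0 from div_pos (mul_pos hM_pos hux) (Real.exp_pos U))
      (show M * v x / Real.exp V ∈ Set.Ioi 0 from div_pos (mul_pos hM_pos hvx) (Real.exp_pos V))
      hθ_nonneg hη_nonneg hsum
    have hw_eq : θ * (M * u x / Real.exp U) + η * (M * v x / Real.exp V) =
        c * u x + (1 - c) * v x := by
      rw [hθ, hη]
      field_simp
    simp only [smul_eq_mul] at key
    rw [hw_eq, Real.log_div (mul_pos hM_pos hux).ne' (Real.exp_pos U).ne',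
      Real.log_div (mul_pos hM_pos hvx).ne' (Real.exp_pos V).ne',
      Real.log_mul hM_pos.ne' hux.ne', Real.log_mul hM_pos.ne' hvx.ne',
      Real.log_exp, Real.log_exp] at key
    linear_combination key - Real.log M * hsum
  have hint : Integrable (fun x => θ * Real.log (u x) + η * Real.log (v x)) μ :=
    (hu.const_mul θ).add (hv.const_mul η)
  have hmono := integral_mono_ae (hint.add (integrable_const (Real.log M - θ * U - η * V))) hw hpt
  simp only [Pi.add_apply] at hmono
  rw [integral_add hint (integrable_const _), integral_add (hu.const_mul θ) (hv.const_mul η),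
    integral_const_mul, integral_const_mul, integral_const, ← hU, ← hV, probReal_univ,
    one_smul] at hmono
  rw [← Real.log_le_iff_le_exp hM_pos]
  linarith

/-- Lemma D.8: the discounted geometric mean
`f(p) = exp(∫ log(p·a + (1−p)·b) dμ)/eʳ` of the mixture of two games
is concave on `[0,1]`. -/
theorem stmt8 {X : Type*} [MeasurableSpace X] (μ : Measure X) [IsProbabilityMeasure μ]
    (a b : X → ℝ) (ha_meas : Measurable a) (hb_meas : Measurable b)
    (ha_pos : ∀ᵐ x ∂μ, 0 < a x) (hb_pos : ∀ᵐ x ∂μ, 0 < b x)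
    (hloga : Integrable (fun x => Real.log (a x)) μ)
    (hlogb : Integrable (fun x => Real.log (b x)) μ)
    (r : ℝ) (f : ℝ → ℝ)
    (hf : ∀ p, f p = Real.exp (∫ x, Real.log (p * a x + (1 - p) * b x) ∂μ) / Real.exp r) :
    ∀ p ∈ Set.Icc (0 : ℝ) 1, ∀ q ∈ Set.Icc (0 : ℝ) 1, ∀ lam ∈ Set.Icc (0 : ℝ) 1,
      lam * f p + (1 - lam) * f q ≤ f (lam * p + (1 - lam) * q) := by
  intro p hp q hq lam hlam
  have hint := fun {t : ℝ} (ht : t ∈ Set.Icc (0 : ℝ) 1) =>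
    integrable_log_convexComb ha_meas.aemeasurable hb_meas.aemeasurable ha_pos hb_pos hloga hlogb ht
  have hpos : ∀ t ∈ Set.Icc (0 : ℝ) 1, ∀ᵐ x ∂μ, 0 < t * a x + (1 - t) * b x := by
    intro t ht
    filter_upwards [ha_pos, hb_pos] with x hax hbx
    exact convexComb_pos hax hbx ht
  have hmix : lam * p + (1 - lam) * q ∈ Set.Icc (0 : ℝ) 1 :=
    convex_Icc (0 : ℝ) 1 hp hq hlam.1 (sub_nonneg.2 hlam.2) (add_sub_cancel lam 1)
  have hcomb : (fun x => Real.log ((lam * p + (1 - lam) * q) * a x +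
      (1 - (lam * p + (1 - lam) * q)) * b x)) =
      fun x => Real.log (lam * (p * a x + (1 - p) * b x) +
        (1 - lam) * (q * a x + (1 - q) * b x)) := by
    funext x
    ring_nf
  have hw := hint hmix
  rw [hcomb] at hw
  rw [hf, hf, hf, hcomb, ← mul_div_assoc, ← mul_div_assoc, ← add_div]
  gcongr
  exact exp_integral_log_concave (hpos p hp) (hpos q hq) (hint hp) (hint hq) hlam hw
end

section
/- Let (X, μ) be a probability space, let a, b : X → ℝ be measurable with a > 0 and b > 0 almost everywhere, and suppose 1/a and 1/b are integrable. Define h(p) := 1/(∫ 1/(p·a(x) + (1−p)·b(x)) dμ(x)) for p ∈ [0,1]. Then h is concave on [0,1]; that is, λ·h(p) + (1−λ)·h(q) ≤ h(λ·p + (1−λ)·q) for all p, q, λ ∈ [0,1]. -/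
open MeasureTheory

/-- A function which is almost everywhere positive has positive integral. -/
theorem integral_pos_of_ae_pos {X : Type*} [MeasurableSpace X] {μ : Measure X} [NeZero μ]
    {f : X → ℝ} (hf : Integrable f μ) (hpos : ∀ᵐ x ∂μ, 0 < f x) : 0 < ∫ x, f x ∂μ := by
  have h_nonneg : 0 ≤ᵐ[μ] f := hpos.mono fun x hx => hx.le
  refine (integral_nonneg_of_ae h_nonneg).lt_of_ne' fun h0 => ?_
  have h_zero := (integral_eq_zero_iff_of_nonneg_ae h_nonneg hf).1 h0
  obtain ⟨x, hx, hx0⟩ := (hpos.and h_zero).exists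
  exact hx.ne' hx0

theorem convexCombo_pos {l f g : ℝ} (hl : l ∈ Set.Icc (0 : ℝ) 1) (hf : 0 < f) (hg : 0 < g) :
    0 < l * f + (1 - l) * g :=
  convex_Ioi (0 : ℝ) hf hg hl.1 (sub_nonneg.2 hl.2) (by ring)

/-- A weighted form of the Cauchy-Schwarz inequality for two terms. -/
theorem sq_convexCombo_mul_one_div_le {l f g : ℝ} (hl : l ∈ Set.Icc (0 : ℝ) 1)
    (hf : 0 < f) (hg : 0 < g) (c d : ℝ) :
    (l * c + (1 - l) * d) ^ 2 * (1 / (l * f + (1 - l) * g)) ≤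
      l * c ^ 2 * (1 / f) + (1 - l) * d ^ 2 * (1 / g) := by
  have hu := convexCombo_pos hl hf hg
  have hm : 0 ≤ l * (1 - l) := mul_nonneg hl.1 (sub_nonneg.2 hl.2)
  have key : l * c ^ 2 * (1 / f) + (1 - l) * d ^ 2 * (1 / g)
      - (l * c + (1 - l) * d) ^ 2 * (1 / (l * f + (1 - l) * g))
      = l * (1 - l) * (c * g - d * f) ^ 2 / (f * g * (l * f + (1 - l) * g)) := by
    have hu' := hu.ne'
    field_simp
    ring
  rw [← sub_nonneg, key]
  positivity

theorem integrable_one_div_convexCombo {X : Type*} [MeasurableSpace X] {μ : Measure X}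
    {f g : X → ℝ} (hf_meas : Measurable f) (hg_meas : Measurable g)
    (hf_pos : ∀ᵐ x ∂μ, 0 < f x) (hg_pos : ∀ᵐ x ∂μ, 0 < g x)
    (hf : Integrable (fun x => 1 / f x) μ) (hg : Integrable (fun x => 1 / g x) μ)
    {l : ℝ} (hl : l ∈ Set.Icc (0 : ℝ) 1) :
    Integrable (fun x => 1 / (l * f x + (1 - l) * g x)) μ := by
  refine ((hf.const_mul l).add (hg.const_mul (1 - l))).mono'
    (Measurable.aestronglyMeasurable (by fun_prop)) ?_
  filter_upwards [hf_pos, hg_pos] with x hx hy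
  have hu := convexCombo_pos hl hx hy
  rw [Real.norm_of_nonneg (by positivity)]
  simpa using sq_convexCombo_mul_one_div_le hl hx hy 1 1

/-- The harmonic mean is a concave functional of positive functions. -/
theorem convexCombo_harmonicMean_le {X : Type*} [MeasurableSpace X] {μ : Measure X} [NeZero μ]
    {f g : X → ℝ} (hf_meas : Measurable f) (hg_meas : Measurable g)
    (hf_pos : ∀ᵐ x ∂μ, 0 < f x) (hg_pos : ∀ᵐ x ∂μ, 0 < g x)
    (hf : Integrable (fun x => 1 / f x) μ) (hg : Integrable (fun x => 1 / g x) μ)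
    {l : ℝ} (hl : l ∈ Set.Icc (0 : ℝ) 1) :
    l * (1 / ∫ x, 1 / f x ∂μ) + (1 - l) * (1 / ∫ x, 1 / g x ∂μ) ≤
      1 / ∫ x, 1 / (l * f x + (1 - l) * g x) ∂μ := by
  have hu := integrable_one_div_convexCombo hf_meas hg_meas hf_pos hg_pos hf hg hl
  have hF := integral_pos_of_ae_pos hf (hf_pos.mono fun x hx => one_div_pos.2 hx)
  have hG := integral_pos_of_ae_pos hg (hg_pos.mono fun x hx => one_div_pos.2 hx)
  have hU := integral_pos_of_ae_pos hu
    ((hf_pos.and hg_pos).mono fun x hx => one_div_pos.2 (convexCombo_pos hl hx.1 hx.2))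
  set F := ∫ x, 1 / f x ∂μ
  set G := ∫ x, 1 / g x ∂μ
  set S := l * (1 / F) + (1 - l) * (1 / G) with hS
  have hS_pos : 0 < S := convexCombo_pos hl (one_div_pos.2 hF) (one_div_pos.2 hG)
  have h_int := integral_mono_ae (hu.const_mul (S ^ 2))
    ((hf.const_mul (l * (1 / F) ^ 2)).add (hg.const_mul ((1 - l) * (1 / G) ^ 2)))
    ((hf_pos.and hg_pos).mono fun x hx =>
      sq_convexCombo_mul_one_div_le hl hx.1 hx.2 (1 / F) (1 / G))
  rw [integral_add' (hf.const_mul _) (hg.const_mul _), integral_const_mul, integral_const_mul,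
    integral_const_mul] at h_int
  have h_eq : l * (1 / F) ^ 2 * F + (1 - l) * (1 / G) ^ 2 * G = S := by
    rw [hS]
    field_simp
  rw [le_div_iff₀ hU]
  refine le_of_mul_le_mul_left ?_ hS_pos
  calc _ = S ^ 2 * ∫ x, 1 / (l * f x + (1 - l) * g x) ∂μ := by ring
    _ ≤ S := h_int.trans_eq h_eq
    _ = S * 1 := (mul_one S).symm

/-- Lemma D.10: the harmonic mean
`h(p) = 1/∫ 1/(p·a + (1−p)·b) dμ` of the mixture of two games
is concave on `[0,1]`. -/
theorem stmt9 {X : Type*} [MeasurableSpace X] (μ : Measure X) [IsProbabilityMeasure μ]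
    (a b : X → ℝ) (ha_meas : Measurable a) (hb_meas : Measurable b)
    (ha_pos : ∀ᵐ x ∂μ, 0 < a x) (hb_pos : ∀ᵐ x ∂μ, 0 < b x)
    (hinva : Integrable (fun x => 1 / a x) μ)
    (hinvb : Integrable (fun x => 1 / b x) μ)
    (h : ℝ → ℝ)
    (hh : ∀ p, h p = 1 / ∫ x, 1 / (p * a x + (1 - p) * b x) ∂μ) :
    ∀ p ∈ Set.Icc (0 : ℝ) 1, ∀ q ∈ Set.Icc (0 : ℝ) 1, ∀ lam ∈ Set.Icc (0 : ℝ) 1,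
      lam * h p + (1 - lam) * h q ≤ h (lam * p + (1 - lam) * q) := by
  intro p hp q hq lam hlam
  have h_pos {r : ℝ} (hr : r ∈ Set.Icc (0 : ℝ) 1) : ∀ᵐ x ∂μ, 0 < r * a x + (1 - r) * b x :=
    (ha_pos.and hb_pos).mono fun x hx => convexCombo_pos hr hx.1 hx.2
  have h_int {r : ℝ} (hr : r ∈ Set.Icc (0 : ℝ) 1) :=
    integrable_one_div_convexCombo ha_meas hb_meas ha_pos hb_pos hinva hinvb hr
  have h_mix (x : X) : (lam * p + (1 - lam) * q) * a x + (1 - (lam * p + (1 - lam) * q)) * b x =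
      lam * (p * a x + (1 - p) * b x) + (1 - lam) * (q * a x + (1 - q) * b x) := by ring
  simp only [hh, h_mix]
  exact convexCombo_harmonicMean_le (by fun_prop) (by fun_prop) (h_pos hp) (h_pos hq)
    (h_int hp) (h_int hq) hlam
end

section
/- Let (X, μ) be a probability space, let a, b : X → ℝ be measurable with a > 0 and b > 0 almost everywhere, and suppose log∘a and log∘b are integrable. Let r ∈ ℝ and define f(p) := exp(∫ log(p·a(x) + (1−p)·b(x)) dμ(x))/e^r for p ∈ [0,1]. Then f is continuous on the closed interval [0,1], including at the endpoints p = 0 and p = 1. -/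
open MeasureTheory

lemma convexCombination_mem_Icc_min_max {s t p : ℝ} (hp : p ∈ Set.Icc (0 : ℝ) 1) :
    p * s + (1 - p) * t ∈ Set.Icc (min s t) (max s t) := by
  obtain ⟨h0, h1⟩ := hp
  have h1' : 0 ≤ 1 - p := sub_nonneg.mpr h1
  constructor
  · nlinarith [mul_le_mul_of_nonneg_left (min_le_left s t) h0,
      mul_le_mul_of_nonneg_left (min_le_right s t) h1']
  · nlinarith [mul_le_mul_of_nonneg_left (le_max_left s t) h0,
      mul_le_mul_of_nonneg_left (le_max_right s t) h1']

lemma convexCombination_pos {s t p : ℝ} (hs : 0 < s) (ht : 0 < t)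
    (hp : p ∈ Set.Icc (0 : ℝ) 1) : 0 < p * s + (1 - p) * t :=
  (lt_min hs ht).trans_le (convexCombination_mem_Icc_min_max hp).1

lemma abs_log_convexCombination_le {s t p : ℝ} (hs : 0 < s) (ht : 0 < t)
    (hp : p ∈ Set.Icc (0 : ℝ) 1) :
    |Real.log (p * s + (1 - p) * t)| ≤ |Real.log s| + |Real.log t| := by
  obtain ⟨hmin, hmax⟩ := convexCombination_mem_Icc_min_max (s := s) (t := t) hp
  have hlower := Real.log_le_log (lt_min hs ht) hmin
  have hupper := Real.log_le_log (convexCombination_pos hs ht hp) hmax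
  rw [abs_le]
  constructor
  · rcases min_choice s t with h | h <;> rw [h] at hlower <;>
      linarith [neg_abs_le (Real.log s), neg_abs_le (Real.log t),
        abs_nonneg (Real.log s), abs_nonneg (Real.log t)]
  · rcases max_choice s t with h | h <;> rw [h] at hupper <;>
      linarith [le_abs_self (Real.log s), le_abs_self (Real.log t),
        abs_nonneg (Real.log s), abs_nonneg (Real.log t)]

/-- Lemma D.11: the discounted geometric mean
`f(p) = exp(∫ log(p·a + (1−p)·b) dμ)/eʳ` of the mixture of two games
is continuous on the closed interval `[0,1]`. -/
theorem stmt10 {X : Type*} [MeasurableSpace X] (μ : Measure X) [IsProbabilityMeasure μ]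
    (a b : X → ℝ) (ha_meas : Measurable a) (hb_meas : Measurable b)
    (ha_pos : ∀ᵐ x ∂μ, 0 < a x) (hb_pos : ∀ᵐ x ∂μ, 0 < b x)
    (hloga : Integrable (fun x => Real.log (a x)) μ)
    (hlogb : Integrable (fun x => Real.log (b x)) μ)
    (r : ℝ) (f : ℝ → ℝ)
    (hf : ∀ p, f p = Real.exp (∫ x, Real.log (p * a x + (1 - p) * b x) ∂μ) / Real.exp r) :
    ContinuousOn f (Set.Icc (0 : ℝ) 1) := by
  have hcont : ContinuousOn (fun p => ∫ x, Real.log (p * a x + (1 - p) * b x) ∂μ)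
      (Set.Icc (0 : ℝ) 1) := by
    refine continuousOn_of_dominated
      (bound := fun x => |Real.log (a x)| + |Real.log (b x)|) ?_ ?_ (hloga.abs.add hlogb.abs) ?_
    · intro p _
      exact (Real.measurable_log.comp
        ((ha_meas.const_mul p).add (hb_meas.const_mul (1 - p)))).aestronglyMeasurable
    · intro p hp
      filter_upwards [ha_pos, hb_pos] with x hax hbx
      exact abs_log_convexCombination_le hax hbx hp
    · filter_upwards [ha_pos, hb_pos] with x hax hbx
      exact ContinuousOn.log (by fun_prop) fun p hp => (convexCombination_pos hax hbx hp).ne'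
  rw [funext hf]
  exact hcont.rexp.div_const _
end

section
/- Let (X, μ) be a probability space and let a, b : X → ℝ be measurable and integrable with a > 0 and b > 0 almost everywhere. For p ∈ [0,1] let H(p) := ∫ 1/(p·a(x) + (1−p)·b(x)) dμ(x) ∈ (0, +∞] (the integral taken in the extended sense) and define h(p) := 1/H(p), with the convention h(p) = 0 when H(p) = +∞. Then h is continuous on the closed interval [0,1]. -/
open MeasureTheory ENNReal

open Filter Topology in
/-- Lower semicontinuity of the lower integral (Fatou) turns an infinite limit integral into
divergence of the integrals. -/
theorem tendsto_lintegral_top_of_ae_tendsto {X ι : Type*} [MeasurableSpace X] {μ : Measure X}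
    {l : Filter ι} [l.IsCountablyGenerated] {F : ι → X → ℝ≥0∞} {f : X → ℝ≥0∞}
    (hF : ∀ i, Measurable (F i)) (hlim : ∀ᵐ x ∂μ, Tendsto (fun i => F i x) l (𝓝 (f x)))
    (hf : ∫⁻ x, f x ∂μ = ∞) : Tendsto (fun i => ∫⁻ x, F i x ∂μ) l (𝓝 (∫⁻ x, f x ∂μ)) := by
  refine tendsto_of_seq_tendsto fun u hu => ?_
  have hle : ∫⁻ x, f x ∂μ ≤ liminf (fun n => ∫⁻ x, F (u n) x ∂μ) atTop := by
    refine le_trans (lintegral_mono_ae ?_) (lintegral_liminf_le fun n => hF (u n))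
    filter_upwards [hlim] with x hx
    exact (hx.comp hu).liminf_eq.ge
  refine tendsto_of_le_liminf_of_limsup_le hle ?_
  rw [hf]
  exact le_top

theorem mixture_pos {p s t : ℝ} (hp : p ∈ Set.Icc (0 : ℝ) 1) (hs : 0 < s) (ht : 0 < t) :
    0 < p * s + (1 - p) * t := by
  obtain ⟨h0, h1⟩ := hp
  rcases h0.eq_or_lt with rfl | h0
  · simpa using ht
  · have := mul_pos h0 hs
    have := mul_nonneg (sub_nonneg.2 h1) ht.le
    linarith

open Filter Topology in
theorem eventually_half_le_nhdsWithin_Icc {q : ℝ} (hq : q ∈ Set.Icc (0 : ℝ) 1) :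
    ∀ᶠ p in 𝓝[Set.Icc 0 1] q, q / 2 ≤ p ∧ (1 - q) / 2 ≤ 1 - p := by
  obtain ⟨h0, h1⟩ := hq
  refine Filter.Eventually.and ?_ ?_
  · rcases h0.eq_or_lt with rfl | h0
    · filter_upwards [self_mem_nhdsWithin] with p hp
      simpa using hp.1
    · filter_upwards [mem_nhdsWithin_of_mem_nhds (Ioi_mem_nhds (half_lt_self h0))] with p hp
      exact le_of_lt hp
  · rcases h1.eq_or_lt with rfl | h1
    · filter_upwards [self_mem_nhdsWithin] with p hp
      simpa using hp.2
    · have h2 : q < 1 - (1 - q) / 2 := by linarith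
      filter_upwards [mem_nhdsWithin_of_mem_nhds (Iio_mem_nhds h2)] with p hp
      have : p < 1 - (1 - q) / 2 := hp
      linarith

open Filter Topology in
theorem continuousOn_lintegral_inv_mixture {X : Type*} [MeasurableSpace X] {μ : Measure X}
    {a b : X → ℝ} (ha : Measurable a) (hb : Measurable b)
    (ha_pos : ∀ᵐ x ∂μ, 0 < a x) (hb_pos : ∀ᵐ x ∂μ, 0 < b x) :
    ContinuousOn (fun p : ℝ => ∫⁻ x, ENNReal.ofReal (1 / (p * a x + (1 - p) * b x)) ∂μ)
      (Set.Icc 0 1) := by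
  intro q hq
  have hmeas (p : ℝ) : Measurable fun x => ENNReal.ofReal (1 / (p * a x + (1 - p) * b x)) := by
    fun_prop
  have hlim : ∀ᵐ x ∂μ, Tendsto (fun p => ENNReal.ofReal (1 / (p * a x + (1 - p) * b x)))
      (𝓝[Set.Icc 0 1] q) (𝓝 (ENNReal.ofReal (1 / (q * a x + (1 - q) * b x)))) := by
    filter_upwards [ha_pos, hb_pos] with x hax hbx
    refine ENNReal.tendsto_ofReal (Tendsto.mono_left ?_ nhdsWithin_le_nhds)
    have hc : ContinuousAt (fun p : ℝ => p * a x + (1 - p) * b x) q := by fun_prop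
    exact tendsto_const_nhds.div hc (mixture_pos hq hax hbx).ne'
  by_cases hfin : ∫⁻ x, ENNReal.ofReal (1 / (q * a x + (1 - q) * b x)) ∂μ = ∞
  · exact tendsto_lintegral_top_of_ae_tendsto hmeas hlim hfin
  refine tendsto_lintegral_filter_of_dominated_convergence
    (fun x => 2 * ENNReal.ofReal (1 / (q * a x + (1 - q) * b x)))
    (Eventually.of_forall hmeas) ?_ ?_ hlim
  · filter_upwards [eventually_half_le_nhdsWithin_Icc hq] with p hp
    filter_upwards [ha_pos, hb_pos] with x hax hbx
    have hpos := mixture_pos hq hax hbx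
    have hle : (q * a x + (1 - q) * b x) / 2 ≤ p * a x + (1 - p) * b x := by
      have := mul_le_mul_of_nonneg_right hp.1 hax.le
      have := mul_le_mul_of_nonneg_right hp.2 hbx.le
      linarith
    rw [← ENNReal.ofReal_ofNat 2, ← ENNReal.ofReal_mul zero_le_two]
    refine ENNReal.ofReal_le_ofReal ((one_div_le_one_div_of_le (half_pos hpos) hle).trans_eq ?_)
    field_simp
  · rw [lintegral_const_mul _ (hmeas q)]
    exact ENNReal.mul_ne_top ofNat_ne_top hfin

theorem lintegral_inv_mixture_ne_zero {X : Type*} [MeasurableSpace X] {μ : Measure X} [NeZero μ]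
    {a b : X → ℝ} (ha : Measurable a) (hb : Measurable b)
    (ha_pos : ∀ᵐ x ∂μ, 0 < a x) (hb_pos : ∀ᵐ x ∂μ, 0 < b x)
    {p : ℝ} (hp : p ∈ Set.Icc (0 : ℝ) 1) :
    ∫⁻ x, ENNReal.ofReal (1 / (p * a x + (1 - p) * b x)) ∂μ ≠ 0 := by
  rw [Ne, lintegral_eq_zero_iff (by fun_prop)]
  intro h0
  obtain ⟨x, hx, hax, hbx⟩ := (h0.and (ha_pos.and hb_pos)).exists
  exact (ENNReal.ofReal_pos.2 (one_div_pos.2 (mixture_pos hp hax hbx))).ne' hx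

/-- Lemma D.12: the harmonic mean `h(p) = 1/H(p)` of the mixture of two games,
where `H(p) = ∫ 1/(p·a + (1−p)·b) dμ ∈ (0,∞]` is taken in the extended sense
(with the convention `h(p) = 0` when `H(p) = ∞`), is continuous on `[0,1]`. -/
theorem stmt11 {X : Type*} [MeasurableSpace X] (μ : Measure X) [IsProbabilityMeasure μ]
    (a b : X → ℝ) (ha_meas : Measurable a) (hb_meas : Measurable b)
    (ha_pos : ∀ᵐ x ∂μ, 0 < a x) (hb_pos : ∀ᵐ x ∂μ, 0 < b x)
    (ha_int : Integrable a μ) (hb_int : Integrable b μ)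
    (H : ℝ → ℝ≥0∞) (h : ℝ → ℝ)
    (hH : ∀ p, H p = ∫⁻ x, ENNReal.ofReal (1 / (p * a x + (1 - p) * b x)) ∂μ)
    (hh : ∀ p, h p = ((H p)⁻¹).toReal) :
    ContinuousOn h (Set.Icc (0 : ℝ) 1) := by
  intro p hp
  have hne : (H p)⁻¹ ≠ ∞ := by
    rw [hH, Ne, ENNReal.inv_eq_top]
    exact lintegral_inv_mixture_ne_zero ha_meas hb_meas ha_pos hb_pos hp
  have hcont : ContinuousWithinAt H (Set.Icc 0 1) p := by
    rw [funext hH]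
    exact continuousOn_lintegral_inv_mixture ha_meas hb_meas ha_pos hb_pos p hp
  rw [funext hh]
  exact (ENNReal.tendsto_toReal hne).comp hcont.inv
end

section
/- Let n ≥ 1 and δ > 0. Let α : (−δ,δ)ⁿ × (0,δ) → ℝ be continuous and nondecreasing in its last variable, i.e. for each x ∈ (−δ,δ)ⁿ the map y ↦ α(x,y) is nondecreasing on (0,δ). Let β : (−δ,δ)ⁿ → ℝ be continuous and suppose lim_{y→0⁺} α(x,y) = β(x) for each x ∈ (−δ,δ)ⁿ. Then the extension α̃ : (−δ,δ)ⁿ × [0,δ) → ℝ defined by α̃(x,y) = α(x,y) for y > 0 and α̃(x,0) = β(x) is continuous on (−δ,δ)ⁿ × [0,δ), and it is the unique continuous extension of α to this set. -/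
open Set Filter Topology in
/-- A function on `S ×ˢ Ico a b` that is continuous on `S ×ˢ Ioo a b`, monotone in its second
variable there, continuous on the boundary slice, and continuous from the right at `a` in its
second variable, is jointly continuous. -/
theorem continuousOn_prod_Ico_of_monotoneOn {X Y : Type*} [TopologicalSpace X]
    [TopologicalSpace Y] [LinearOrder Y] [OrderTopology Y] {S : Set X} {a b : ℝ} {f : X → ℝ → Y}
    (hf : ContinuousOn (fun q : X × ℝ => f q.1 q.2) (S ×ˢ Ioo a b))
    (hmono : ∀ x ∈ S, MonotoneOn (f x) (Ioo a b))
    (hbdry : ContinuousOn (fun x => f x a) S)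
    (hlim : ∀ x ∈ S, Tendsto (f x) (𝓝[>] a) (𝓝 (f x a))) :
    ContinuousOn (fun q : X × ℝ => f q.1 q.2) (S ×ˢ Ico a b) := by
  have boundary_le : ∀ x ∈ S, ∀ y ∈ Ioo a b, f x a ≤ f x y := fun x hx y hy =>
    le_of_tendsto (hlim x hx) <| by
      filter_upwards [Ioo_mem_nhdsGT hy.1] with z hz
      exact hmono x hx ⟨hz.1, hz.2.trans hy.2⟩ hy hz.2.le
  rintro ⟨x, y⟩ ⟨hx : x ∈ S, hy : y ∈ Ico a b⟩
  rcases hy.1.eq_or_lt with rfl | hay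
  · have hfst : Tendsto Prod.fst (𝓝[S ×ˢ Ico a b] (x, a)) (𝓝[S] x) :=
      tendsto_nhdsWithin_iff.2 ⟨continuous_fst.continuousWithinAt,
        eventually_mem_nhdsWithin.mono fun q hq => hq.1⟩
    refine tendsto_order.2 ⟨fun c hc => ?_, fun c hc => ?_⟩
    · filter_upwards [hfst.eventually ((hbdry x hx).eventually (lt_mem_nhds hc)),
        self_mem_nhdsWithin] with q hq hqS
      rcases hqS.2.1.eq_or_lt with h | h
      · rwa [← h]
      · exact hq.trans_le (boundary_le q.1 hqS.1 q.2 ⟨h, hqS.2.2⟩)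
    · obtain ⟨z, hzc, hz⟩ := (((hlim x hx).eventually (gt_mem_nhds hc)).and
        (Ioo_mem_nhdsGT hy.2)).exists
      have hslice : ContinuousOn (fun x => f x z) S :=
        hf.comp (f := fun x => (x, z)) (by fun_prop) fun x hx => ⟨hx, hz⟩
      filter_upwards [hfst.eventually ((hslice x hx).eventually (gt_mem_nhds hzc)),
        self_mem_nhdsWithin, mem_nhdsWithin_of_mem_nhds
          (continuous_snd.continuousAt.eventually (gt_mem_nhds hz.1))] with q hq hqS hqz
      refine lt_of_le_of_lt ?_ hq
      rcases hqS.2.1.eq_or_lt with h | h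
      · rw [← h]
        exact boundary_le q.1 hqS.1 z hz
      · exact hmono q.1 hqS.1 ⟨h, hqS.2.2⟩ hz (hqz.le)
  · refine (hf (x, y) ⟨hx, hay, hy.2⟩).mono_of_mem_nhdsWithin ?_
    filter_upwards [self_mem_nhdsWithin, mem_nhdsWithin_of_mem_nhds
      (continuous_snd.continuousAt.eventually (lt_mem_nhds hay))] with q hqS hq
    exact ⟨hqS.1, hq, hqS.2.2⟩

/-- Lemma D.13 (gluing lemma): a function `α` on `(−δ,δ)ⁿ × (0,δ)` that is
continuous, nondecreasing in its last variable, and converges pointwise as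
`y → 0⁺` to a continuous function `β` on `(−δ,δ)ⁿ`, extends (by `β` at
`y = 0`) to a continuous function on `(−δ,δ)ⁿ × [0,δ)`, and this is the
unique continuous extension. -/
theorem stmt12 (n : ℕ) (hn : 1 ≤ n) (δ : ℝ) (hδ : 0 < δ)
    (α : (Fin n → ℝ) → ℝ → ℝ) (β : (Fin n → ℝ) → ℝ)
    (hα_cont : ContinuousOn (fun q : (Fin n → ℝ) × ℝ => α q.1 q.2)
      {q : (Fin n → ℝ) × ℝ | (∀ i, q.1 i ∈ Set.Ioo (-δ) δ) ∧ q.2 ∈ Set.Ioo 0 δ})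
    (hα_mono : ∀ x : Fin n → ℝ, (∀ i, x i ∈ Set.Ioo (-δ) δ) →
      MonotoneOn (α x) (Set.Ioo 0 δ))
    (hβ_cont : ContinuousOn β {x : Fin n → ℝ | ∀ i, x i ∈ Set.Ioo (-δ) δ})
    (hlim : ∀ x : Fin n → ℝ, (∀ i, x i ∈ Set.Ioo (-δ) δ) →
      Filter.Tendsto (α x) (nhdsWithin 0 (Set.Ioi 0)) (nhds (β x)))
    (αext : (Fin n → ℝ) → ℝ → ℝ)
    (hαext : ∀ x y, αext x y = if y = 0 then β x else α x y) :
    ContinuousOn (fun q : (Fin n → ℝ) × ℝ => αext q.1 q.2)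
      {q : (Fin n → ℝ) × ℝ | (∀ i, q.1 i ∈ Set.Ioo (-δ) δ) ∧ q.2 ∈ Set.Ico 0 δ} ∧
    ∀ γ : (Fin n → ℝ) → ℝ → ℝ,
      ContinuousOn (fun q : (Fin n → ℝ) × ℝ => γ q.1 q.2)
        {q : (Fin n → ℝ) × ℝ | (∀ i, q.1 i ∈ Set.Ioo (-δ) δ) ∧ q.2 ∈ Set.Ico 0 δ} →
      (∀ x y, (∀ i, x i ∈ Set.Ioo (-δ) δ) → y ∈ Set.Ioo 0 δ → γ x y = α x y) →
      ∀ x y, (∀ i, x i ∈ Set.Ioo (-δ) δ) → y ∈ Set.Ico 0 δ → γ x y = αext x y := by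
  have ext_pos : ∀ x, ∀ y ∈ Set.Ioo 0 δ, αext x y = α x y := fun x y hy => by
    rw [hαext, if_neg hy.1.ne']
  have ext_zero : ∀ x, αext x 0 = β x := fun x => by rw [hαext, if_pos rfl]
  refine ⟨continuousOn_prod_Ico_of_monotoneOn
    (S := {x : Fin n → ℝ | ∀ i, x i ∈ Set.Ioo (-δ) δ}) ?_ ?_ ?_ ?_, ?_⟩
  · exact hα_cont.congr fun q hq => ext_pos q.1 q.2 hq.2
  · exact fun x hx => (hα_mono x hx).congr fun y hy => (ext_pos x y hy).symm
  · exact hβ_cont.congr fun x _ => ext_zero x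
  · intro x hx
    rw [ext_zero]
    refine (hlim x hx).congr' ?_
    filter_upwards [Ioo_mem_nhdsGT hδ] with y hy using (ext_pos x y hy).symm
  · intro γ hγ hγα x y hx hy
    rcases hy.1.eq_or_lt with rfl | hy0
    · have hslice : ContinuousOn (γ x) (Set.Ico 0 δ) :=
        hγ.comp (f := fun y => (x, y)) (by fun_prop) fun y hy => ⟨hx, hy⟩
      have hγlim : Filter.Tendsto (γ x) (nhdsWithin 0 (Set.Ioi 0)) (nhds (γ x 0)) :=
        (hslice 0 hy).mono_of_mem_nhdsWithin <|
          Filter.mem_of_superset (Ioo_mem_nhdsGT hδ) Set.Ioo_subset_Ico_self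
      rw [ext_zero]
      refine tendsto_nhds_unique hγlim ((hlim x hx).congr' ?_)
      filter_upwards [Ioo_mem_nhdsGT hδ] with z hz using (hγα x z hx hz).symm
    · rw [hγα x y hx ⟨hy0, hy.2⟩, ext_pos x y ⟨hy0, hy.2⟩]
end

section
/- Let (X, μ) be a probability space, let c, d : X → ℝ be measurable with c > 0 and d > 0 almost everywhere and log∘c, log∘d integrable, let r ∈ ℝ and λ ∈ [0,1]. Suppose there are u_C > 0, u_D > 0, u* > 0 and t_C, t_D ∈ (0,1], t* ∈ [0,1] such that: (i) t ↦ ∫ log(c(x)·t/u_C − t + 1) dμ attains its maximum over [0,1] at t_C with value r; (ii) t ↦ ∫ log(d(x)·t/u_D − t + 1) dμ attains its maximum over [0,1] at t_D with value r; and (iii) t ↦ ∫ log((λ·c(x) + (1−λ)·d(x))·t/u* − t + 1) dμ attains its maximum over [0,1] at t* with value r. Then u* ≥ λ·u_C + (1−λ)·u_D. -/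
open MeasureTheory

/-- Weighted arithmetic mean inequality for the logarithm (concavity of `Real.log`). -/
theorem log_mean_le {p q x y : ℝ} (hp : 0 ≤ p) (hq : 0 ≤ q) (hpq : p + q = 1)
    (hx : 0 < x) (hy : 0 < y) :
    p * Real.log x + q * Real.log y ≤ Real.log (p * x + q * y) := by
  simpa using strictConcaveOn_log_Ioi.concaveOn.2 hx hy hp hq hpq

theorem mean_pos {p q x y : ℝ} (hp : 0 ≤ p) (hq : 0 ≤ q) (hpq : p + q = 1)
    (hx : 0 < x) (hy : 0 < y) : 0 < p * x + q * y := by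
  simpa using (convex_Ioi (0 : ℝ)) hx hy hp hq hpq

theorem abs_log_mean_le {p q x y : ℝ} (hp : 0 ≤ p) (hq : 0 ≤ q) (hpq : p + q = 1)
    (hx : 0 < x) (hy : 0 < y) :
    |Real.log (p * x + q * y)| ≤ |Real.log x| + |Real.log y| := by
  have hpos := mean_pos hp hq hpq hx hy
  wlog hxy : x ≤ y generalizing p q x y
  · have := this hq hp (by linarith) hy hx (by linarith) (by linarith)
    rw [add_comm (p * x), add_comm |Real.log x|]
    exact this
  have h₁ : Real.log x ≤ Real.log (p * x + q * y) :=
    Real.log_le_log hx (by nlinarith)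
  have h₂ : Real.log (p * x + q * y) ≤ Real.log y :=
    Real.log_le_log hpos (by nlinarith)
  rw [abs_le]
  constructor
  · linarith [neg_abs_le (Real.log x), abs_nonneg (Real.log y)]
  · linarith [le_abs_self (Real.log y), abs_nonneg (Real.log x)]

theorem integrable_log_mean {X : Type*} [MeasurableSpace X] {μ : Measure X}
    {f g : X → ℝ} (hf : Measurable f) (hg : Measurable g)
    (hf_pos : ∀ᵐ x ∂μ, 0 < f x) (hg_pos : ∀ᵐ x ∂μ, 0 < g x)
    (hlogf : Integrable (fun x => Real.log (f x)) μ)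
    (hlogg : Integrable (fun x => Real.log (g x)) μ)
    {p q : ℝ} (hp : 0 ≤ p) (hq : 0 ≤ q) (hpq : p + q = 1) :
    Integrable (fun x => Real.log (p * f x + q * g x)) μ := by
  refine (hlogf.abs.add hlogg.abs).mono'
    (((hf.const_mul p).add (hg.const_mul q)).log.aestronglyMeasurable) ?_
  filter_upwards [hf_pos, hg_pos] with x hx hy
  exact abs_log_mean_le hp hq hpq hx hy

/-- Log-returns are integrable when a proportion `t` is invested at price `u`. -/
theorem integrable_log_return {X : Type*} [MeasurableSpace X] {μ : Measure X}
    [IsProbabilityMeasure μ] {f : X → ℝ} (hf : Measurable f) (hf_pos : ∀ᵐ x ∂μ, 0 < f x)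
    (hlogf : Integrable (fun x => Real.log (f x)) μ) {u t : ℝ} (hu : 0 < u)
    (ht : t ∈ Set.Icc (0 : ℝ) 1) :
    Integrable (fun x => Real.log (f x * t / u - t + 1)) μ := by
  have hlog : Integrable (fun x => Real.log (f x / u)) μ := by
    refine (hlogf.sub (integrable_const (Real.log u))).congr ?_
    filter_upwards [hf_pos] with x hx
    exact (Real.log_div hx.ne' hu.ne').symm
  have hpos : ∀ᵐ x ∂μ, 0 < f x / u := hf_pos.mono fun x hx => div_pos hx hu
  have h := integrable_log_mean (hf.div_const u) (measurable_const (a := (1 : ℝ))) hpos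
    (Filter.Eventually.of_forall fun _ => one_pos) hlog (integrable_const _) ht.1
    (sub_nonneg.2 ht.2) (add_sub_cancel t 1)
  refine h.congr (Filter.Eventually.of_forall fun x => ?_)
  exact congrArg Real.log (by ring)

theorem return_pos {y u t : ℝ} (hy : 0 < y) (hu : 0 < u) (ht : t ∈ Set.Icc (0 : ℝ) 1) :
    0 < y * t / u - t + 1 := by
  have h := mean_pos ht.1 (sub_nonneg.2 ht.2) (add_sub_cancel t 1) (div_pos hy hu) one_pos
  have e : y * t / u - t + 1 = t * (y / u) + (1 - t) * 1 := by ring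
  rwa [e]

theorem integral_lt_integral_of_ae_lt {X : Type*} [MeasurableSpace X] {μ : Measure X}
    [NeZero μ] {f g : X → ℝ} (hf : Integrable f μ) (hg : Integrable g μ)
    (hfg : ∀ᵐ x ∂μ, f x < g x) : ∫ x, f x ∂μ < ∫ x, g x ∂μ := by
  refine lt_of_le_of_ne (integral_mono_ae hf hg (hfg.mono fun x hx => hx.le)) fun h => ?_
  have heq := (integral_eq_iff_of_ae_le hf hg (hfg.mono fun x hx => hx.le)).1 h
  obtain ⟨x, hx, hx'⟩ := (heq.and hfg).exists
  exact hx'.ne hx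

/-- Lemma D.9 (superadditivity of the price under mixtures): if the prices
`u_C`, `u_D`, `u*` of the games with payoffs `c`, `d`, `λc + (1−λ)d` are
characterized by the maximality conditions (i)–(iii), then
`u* ≥ λ·u_C + (1−λ)·u_D`. -/
theorem stmt13 {X : Type*} [MeasurableSpace X] (μ : Measure X) [IsProbabilityMeasure μ]
    (c d : X → ℝ) (hc_meas : Measurable c) (hd_meas : Measurable d)
    (hc_pos : ∀ᵐ x ∂μ, 0 < c x) (hd_pos : ∀ᵐ x ∂μ, 0 < d x)
    (hlogc : Integrable (fun x => Real.log (c x)) μ)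
    (hlogd : Integrable (fun x => Real.log (d x)) μ)
    (r lam : ℝ) (hlam : lam ∈ Set.Icc (0 : ℝ) 1)
    (uC uD ustar : ℝ) (huC : 0 < uC) (huD : 0 < uD) (hustar : 0 < ustar)
    (tC tD tstar : ℝ) (htC : tC ∈ Set.Ioc (0 : ℝ) 1) (htD : tD ∈ Set.Ioc (0 : ℝ) 1)
    (htstar : tstar ∈ Set.Icc (0 : ℝ) 1)
    (hmaxC : ∀ t ∈ Set.Icc (0 : ℝ) 1,
      ∫ x, Real.log (c x * t / uC - t + 1) ∂μ ≤ ∫ x, Real.log (c x * tC / uC - tC + 1) ∂μ)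
    (hvalC : ∫ x, Real.log (c x * tC / uC - tC + 1) ∂μ = r)
    (hmaxD : ∀ t ∈ Set.Icc (0 : ℝ) 1,
      ∫ x, Real.log (d x * t / uD - t + 1) ∂μ ≤ ∫ x, Real.log (d x * tD / uD - tD + 1) ∂μ)
    (hvalD : ∫ x, Real.log (d x * tD / uD - tD + 1) ∂μ = r)
    (hmaxS : ∀ t ∈ Set.Icc (0 : ℝ) 1,
      ∫ x, Real.log ((lam * c x + (1 - lam) * d x) * t / ustar - t + 1) ∂μ ≤
        ∫ x, Real.log ((lam * c x + (1 - lam) * d x) * tstar / ustar - tstar + 1) ∂μ)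
    (hvalS : ∫ x, Real.log ((lam * c x + (1 - lam) * d x) * tstar / ustar - tstar + 1) ∂μ = r) :
    lam * uC + (1 - lam) * uD ≤ ustar := by
  have hq : 0 ≤ 1 - lam := sub_nonneg.2 hlam.2
  have hsum : lam + (1 - lam) = 1 := add_sub_cancel lam 1
  have htC' : tC ∈ Set.Icc (0 : ℝ) 1 := ⟨htC.1.le, htC.2⟩
  have htD' : tD ∈ Set.Icc (0 : ℝ) 1 := ⟨htD.1.le, htD.2⟩
  by_contra! hlt
  set w := lam * uC + (1 - lam) * uD with hw
  have hw_pos : 0 < w := mean_pos hlam.1 hq hsum huC huD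
  set S := lam * (uC / tC) + (1 - lam) * (uD / tD) with hS
  have hS_pos : 0 < S :=
    mean_pos hlam.1 hq hsum (div_pos huC htC.1) (div_pos huD htD.1)
  have hwS : w ≤ S :=
    add_le_add
      (mul_le_mul_of_nonneg_left (le_div_self huC.le htC.1 htC.2) hlam.1)
      (mul_le_mul_of_nonneg_left (le_div_self huD.le htD.1 htD.2) hq)
  set α := lam * (uC / tC) / S with hα
  set β := (1 - lam) * (uD / tD) / S with hβ
  have hα0 : 0 ≤ α := div_nonneg (mul_nonneg hlam.1 (div_pos huC htC.1).le) hS_pos.le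
  have hβ0 : 0 ≤ β := div_nonneg (mul_nonneg hq (div_pos huD htD.1).le) hS_pos.le
  have hαβ : α + β = 1 := by rw [hα, hβ, ← add_div, ← hS, div_self hS_pos.ne']
  have hαC : α * tC = lam * uC / S := by
    have := htC.1.ne'
    rw [hα]; field_simp
  have hβD : β * tD = (1 - lam) * uD / S := by
    have := htD.1.ne'
    rw [hβ]; field_simp
  have ht : w / S ∈ Set.Icc (0 : ℝ) 1 :=
    ⟨(div_pos hw_pos hS_pos).le, (div_le_one hS_pos).2 hwS⟩
  have hIC := integrable_log_return hc_meas hc_pos hlogc huC htC'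
  have hID := integrable_log_return hd_meas hd_pos hlogd huD htD'
  have hm_pos : ∀ᵐ x ∂μ, 0 < lam * c x + (1 - lam) * d x := by
    filter_upwards [hc_pos, hd_pos] with x hx hy
    exact mean_pos hlam.1 hq hsum hx hy
  have hIS := integrable_log_return (by fun_prop) hm_pos
    (integrable_log_mean hc_meas hd_meas hc_pos hd_pos hlogc hlogd hlam.1 hq hsum) hustar ht
  have key := integral_lt_integral_of_ae_lt
    ((hIC.const_mul α).add (hID.const_mul β)) hIS (by
      filter_upwards [hc_pos, hd_pos, hm_pos] with x hx hy hm
      have hP := return_pos hx huC htC'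
      have hQ := return_pos hy huD htD'
      refine (log_mean_le hα0 hβ0 hαβ hP hQ).trans_lt
        (Real.log_lt_log (mean_pos hα0 hβ0 hαβ hP hQ) ?_)
      have e : α * (c x * tC / uC - tC + 1) + β * (d x * tD / uD - tD + 1)
          = (lam * c x + (1 - lam) * d x) * (w / S) / w - w / S + 1 := by
        calc _ = (α * tC) * (c x / uC) + (β * tD) * (d x / uD)
                - (α * tC + β * tD) + (α + β) := by ring
          _ = _ := by
            rw [hαC, hβD, hαβ, ← add_div, ← hw]
            field_simp
      rw [e]
      have := div_lt_div_of_pos_left (mul_pos hm (div_pos hw_pos hS_pos)) hustar hlt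
      linarith)
  have hle := hmaxS (w / S) ht
  have hval : ∫ x, ((fun x => α * Real.log (c x * tC / uC - tC + 1)) +
      fun x => β * Real.log (d x * tD / uD - tD + 1)) x ∂μ = r := by
    rw [integral_add' (hIC.const_mul α) (hID.const_mul β), integral_const_mul,
      integral_const_mul, hvalC, hvalD, ← add_mul, hαβ, one_mul]
  linarith
end

section
/- Let (X, μ) be a probability space, let c : X → [0,∞) be measurable and integrable, let u > 0 and t ∈ [0,1]. Consider the integral I := ∫ (c(x) − u)/(c(x)·t − u·t + u) dμ(x), taken in the extended sense with values in [−∞, +∞) (the integrand is interpreted as −∞ at points where c(x)·t − u·t + u = 0, which can occur only when t = 1 and c(x) = 0, and its positive part is always integrable). Then I = −∞ if and only if t = 1 and ∫ 1/c(x) dμ(x) = +∞, where 1/c(x) is interpreted as +∞ when c(x) = 0. -/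
open MeasureTheory ENNReal

lemma positivePart_le {X : Type*} (c : X → ℝ) (u t : ℝ)
    (hu : 0 < u) (ht : 0 ≤ t) (x : X) :
    ENNReal.ofReal (c x - u) / ENNReal.ofReal (c x * t - u * t + u)
      ≤ ENNReal.ofReal (c x) * (ENNReal.ofReal u)⁻¹ := by
  rcases le_total (c x) u with h | h
  · simp [ENNReal.ofReal_of_nonpos (sub_nonpos.mpr h)]
  · rw [div_eq_mul_inv]
    gcongr
    · linarith
    · nlinarith

lemma negativePart_le {X : Type*} (c : X → ℝ) (u t : ℝ) (hc : ∀ x, 0 ≤ c x)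
    (ht : 0 ≤ t) (x : X) :
    ENNReal.ofReal (u - c x) / ENNReal.ofReal (c x * t - u * t + u)
      ≤ ENNReal.ofReal u / ENNReal.ofReal (u * (1 - t)) := by
  gcongr
  · linarith [hc x]
  · nlinarith [mul_nonneg (hc x) ht]

lemma ofReal_mul_inv_le (u a : ℝ) :
    ENNReal.ofReal u * (ENNReal.ofReal a)⁻¹
      ≤ ENNReal.ofReal (u - a) / ENNReal.ofReal a + 1 := by
  calc ENNReal.ofReal u * (ENNReal.ofReal a)⁻¹
      ≤ (ENNReal.ofReal (u - a) + ENNReal.ofReal a) * (ENNReal.ofReal a)⁻¹ := by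
        gcongr
        simpa using ENNReal.ofReal_add_le (p := u - a) (q := a)
    _ ≤ ENNReal.ofReal (u - a) / ENNReal.ofReal a + 1 := by
        rw [add_mul, div_eq_mul_inv]
        gcongr
        exact ENNReal.mul_inv_le_one _

/-- The last assertion of Lemma D.14: for a nonnegative integrable payoff `c`,
`u > 0` and `t ∈ [0,1]`, the extended-sense integral
`I = ∫ (c − u)/(ct − ut + u) dμ ∈ [−∞, ∞)` (whose positive part, here computed
as `∫⁻ ofReal(c − u)/ofReal(ct − ut + u)`, is always finite) equals `−∞` —
i.e. its negative part `∫⁻ ofReal(u − c)/ofReal(ct − ut + u)` is infinite —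
if and only if `t = 1` and `∫ 1/c dμ = +∞` (with `1/c = +∞` where `c = 0`,
encoded as `(ofReal (c x))⁻¹`). -/
theorem stmt14 {X : Type*} [MeasurableSpace X] (μ : Measure X) [IsProbabilityMeasure μ]
    (c : X → ℝ) (hc_meas : Measurable c) (hc_nonneg : ∀ x, 0 ≤ c x)
    (hc_int : Integrable c μ)
    (u t : ℝ) (hu : 0 < u) (ht : t ∈ Set.Icc (0 : ℝ) 1) :
    (∫⁻ x, ENNReal.ofReal (c x - u) / ENNReal.ofReal (c x * t - u * t + u) ∂μ ≠ ⊤) ∧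
    ((∫⁻ x, ENNReal.ofReal (u - c x) / ENNReal.ofReal (c x * t - u * t + u) ∂μ = ⊤) ↔
      (t = 1 ∧ ∫⁻ x, (ENNReal.ofReal (c x))⁻¹ ∂μ = ⊤)) := by
  obtain ⟨ht0, ht1⟩ := ht
  refine ⟨ne_top_of_le_ne_top ?_ (lintegral_mono (positivePart_le c u t hu ht0)), ?_⟩
  · rw [lintegral_mul_const _ hc_meas.ennreal_ofReal]
    exact ENNReal.mul_ne_top hc_int.lintegral_lt_top.ne (by simpa using hu)
  rcases ht1.lt_or_eq with htlt | rfl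
  · refine iff_of_false (ne_top_of_le_ne_top ?_
      (lintegral_mono (negativePart_le c u t hc_nonneg ht0))) fun h => htlt.ne h.1
    have hpos : 0 < u * (1 - t) := mul_pos hu (sub_pos.mpr htlt)
    simpa using ENNReal.div_ne_top ofReal_ne_top (by simpa using hpos)
  · have hu_ne : ENNReal.ofReal u ≠ 0 := by simpa using hu
    have hscale : ∫⁻ x, ENNReal.ofReal u * (ENNReal.ofReal (c x))⁻¹ ∂μ
        = ENNReal.ofReal u * ∫⁻ x, (ENNReal.ofReal (c x))⁻¹ ∂μ :=
      lintegral_const_mul _ hc_meas.ennreal_ofReal.inv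
    simp only [mul_one, sub_add_cancel, true_and]
    constructor <;> intro h
    · have hle : ∫⁻ x, ENNReal.ofReal (u - c x) / ENNReal.ofReal (c x) ∂μ
          ≤ ∫⁻ x, ENNReal.ofReal u * (ENNReal.ofReal (c x))⁻¹ ∂μ :=
        lintegral_mono fun x => by
          rw [div_eq_mul_inv]
          gcongr
          linarith [hc_nonneg x]
      rw [h, hscale, top_le_iff] at hle
      by_contra hne
      exact ENNReal.mul_ne_top ofReal_ne_top hne hle
    · have hle := lintegral_mono (μ := μ) fun x => ofReal_mul_inv_le u (c x)
      rw [hscale, h, ENNReal.mul_top hu_ne, lintegral_add_right _ measurable_const,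
        top_le_iff] at hle
      simpa using hle
end

section
/- Let (X, μ) be a probability space, let a, b : X → ℝ be measurable and integrable with a > 0 and b > 0 almost everywhere and log∘a, log∘b integrable, and let r ∈ ℝ. For p ∈ [0,1] write c_p(x) := p·a(x) + (1−p)·b(x), and define f(p) := exp(∫ log c_p(x) dμ(x))/e^r and h(p) := 1/(∫ 1/c_p(x) dμ(x)) (equal to 0 if the integral is +∞). Assume f(p) ≥ h(p) for every p ∈ [0,1], and let L ∈ ℝ satisfy f(p) ≤ L for every p ∈ [0,1]. Then the function V(p,t,u) := ∫ log(c_p(x)·t/u − t + 1) dμ(x) is continuous on the compact set D̄ := {(p,t,u) ∈ ℝ³ : 0 ≤ p ≤ 1, 0 ≤ t ≤ 1, f(p) ≤ u ≤ L}. -/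
open MeasureTheory ENNReal

/-- On an interval of positive reals, `|log|` is bounded by the sum of its endpoint values. -/
lemma abs_log_le_abs_log_add_abs_log {x y z : ℝ} (hx : 0 < x) (hxz : x ≤ z) (hzy : z ≤ y) :
    |Real.log z| ≤ |Real.log x| + |Real.log y| := by
  have h1 := Real.log_le_log hx hxz
  have h2 := Real.log_le_log (hx.trans_le hxz) hzy
  rw [abs_le]
  constructor <;>
    linarith [neg_abs_le (Real.log x), le_abs_self (Real.log y), abs_nonneg (Real.log x),
      abs_nonneg (Real.log y)]

lemma convexComb_pos_s15 {x y t : ℝ} (hx : 0 < x) (hy : 0 < y) (ht : t ∈ Set.Icc (0 : ℝ) 1) :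
    0 < t * x + (1 - t) * y := by
  obtain ⟨h0, h1⟩ := ht
  rcases h0.eq_or_lt with rfl | h0
  · simpa using hy
  · have := mul_nonneg (sub_nonneg.2 h1) hy.le
    positivity

lemma abs_log_convexComb_le_s15 {x y t : ℝ} (hx : 0 < x) (hy : 0 < y)
    (ht : t ∈ Set.Icc (0 : ℝ) 1) :
    |Real.log (t * x + (1 - t) * y)| ≤ |Real.log x| + |Real.log y| := by
  obtain ⟨h0, h1⟩ := ht
  rcases le_total x y with h | h
  · exact abs_log_le_abs_log_add_abs_log hx (by nlinarith) (by nlinarith)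
  · rw [add_comm |Real.log x|]
    exact abs_log_le_abs_log_add_abs_log hy (by nlinarith) (by nlinarith)

/-- Lemma D.15: under the assumption `f(p) ≥ h(p)` on `[0,1]` and `f ≤ L`,
the function `V(p,t,u) = ∫ log(c_p(x)·t/u − t + 1) dμ`, where
`c_p = p·a + (1−p)·b`, is continuous on the compact set
`D̄ = {(p,t,u) : 0 ≤ p ≤ 1, 0 ≤ t ≤ 1, f(p) ≤ u ≤ L}`. -/
theorem stmt15 {X : Type*} [MeasurableSpace X] (μ : Measure X) [IsProbabilityMeasure μ]
    (a b : X → ℝ) (ha_meas : Measurable a) (hb_meas : Measurable b)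
    (ha_pos : ∀ᵐ x ∂μ, 0 < a x) (hb_pos : ∀ᵐ x ∂μ, 0 < b x)
    (ha_int : Integrable a μ) (hb_int : Integrable b μ)
    (hloga : Integrable (fun x => Real.log (a x)) μ)
    (hlogb : Integrable (fun x => Real.log (b x)) μ)
    (r L : ℝ) (f h : ℝ → ℝ)
    (hf : ∀ p, f p = Real.exp (∫ x, Real.log (p * a x + (1 - p) * b x) ∂μ) / Real.exp r)
    (hh : ∀ p, h p =
      ((∫⁻ x, ENNReal.ofReal (1 / (p * a x + (1 - p) * b x)) ∂μ)⁻¹).toReal)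
    (hfh : ∀ p ∈ Set.Icc (0 : ℝ) 1, h p ≤ f p)
    (hL : ∀ p ∈ Set.Icc (0 : ℝ) 1, f p ≤ L) :
    ContinuousOn
      (fun q : ℝ × ℝ × ℝ =>
        ∫ x, Real.log ((q.1 * a x + (1 - q.1) * b x) * q.2.1 / q.2.2 - q.2.1 + 1) ∂μ)
      {q : ℝ × ℝ × ℝ | q.1 ∈ Set.Icc (0 : ℝ) 1 ∧ q.2.1 ∈ Set.Icc (0 : ℝ) 1 ∧
        f q.1 ≤ q.2.2 ∧ q.2.2 ≤ L} := by
  set m : ℝ := Real.exp (∫ x, -(|Real.log (a x)| + |Real.log (b x)|) ∂μ) / Real.exp r with hm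
  have hm_pos : 0 < m := by positivity
  have hab_int : Integrable (fun x => |Real.log (a x)| + |Real.log (b x)|) μ :=
    hloga.abs.add hlogb.abs
  have hmf : ∀ p ∈ Set.Icc (0 : ℝ) 1, m ≤ f p := by
    intro p hp
    have hbound : ∀ᵐ x ∂μ, |Real.log (p * a x + (1 - p) * b x)| ≤
        |Real.log (a x)| + |Real.log (b x)| := by
      filter_upwards [ha_pos, hb_pos] with x hax hbx
      exact abs_log_convexComb_le_s15 hax hbx hp
    have hint : Integrable (fun x => Real.log (p * a x + (1 - p) * b x)) μ :=
      hab_int.mono' (Measurable.aestronglyMeasurable (by fun_prop)) hbound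
    rw [hf, hm]
    gcongr ?_ / _
    refine Real.exp_le_exp.2 (integral_mono_ae hab_int.neg hint ?_)
    filter_upwards [hbound] with x hx
    exact (abs_le.1 hx).1
  apply continuousOn_of_dominated
    (bound := fun x => (|Real.log (a x)| + |Real.log (b x)|) + (|Real.log m| + |Real.log L|))
  · intro q _
    exact Measurable.aestronglyMeasurable (by fun_prop)
  · rintro ⟨p, t, u⟩ ⟨hp, ht, hfu, huL⟩
    dsimp only at hp ht hfu huL ⊢
    have hmu : m ≤ u := (hmf p hp).trans hfu
    have hu : 0 < u := hm_pos.trans_le hmu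
    filter_upwards [ha_pos, hb_pos] with x hax hbx
    have hc := convexComb_pos_s15 hax hbx hp
    have hy := abs_log_convexComb_le_s15 (div_pos hc hu) one_pos ht
    rw [Real.log_one, abs_zero, add_zero, Real.log_div hc.ne' hu.ne'] at hy
    have heq : (p * a x + (1 - p) * b x) * t / u - t + 1 =
        t * ((p * a x + (1 - p) * b x) / u) + (1 - t) * 1 := by ring
    rw [heq, Real.norm_eq_abs]
    exact hy.trans <| (abs_sub _ _).trans <| add_le_add (abs_log_convexComb_le_s15 hax hbx hp)
      (abs_log_le_abs_log_add_abs_log hm_pos hmu huL)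
  · exact hab_int.add (integrable_const _)
  · filter_upwards [ha_pos, hb_pos] with x hax hbx
    rintro ⟨p, t, u⟩ ⟨hp, ht, hfu, huL⟩
    dsimp only at hp ht hfu huL
    have hu : 0 < u := hm_pos.trans_le ((hmf p hp).trans hfu)
    have hpos := convexComb_pos_s15 (div_pos (convexComb_pos_s15 hax hbx hp) hu) one_pos ht
    have heq : (p * a x + (1 - p) * b x) * t / u - t + 1 =
        t * ((p * a x + (1 - p) * b x) / u) + (1 - t) * 1 := by ring
    apply ContinuousAt.continuousWithinAt
    refine ContinuousAt.log ?_ (by dsimp only; rw [heq]; exact hpos.ne')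
    have := hu.ne'
    fun_prop (disch := assumption)
end

section
/- Let (X, μ) be a probability space, let a, b : X → ℝ be measurable and integrable with a > 0 and b > 0 almost everywhere and log∘a, log∘b integrable, and let r ∈ ℝ. For p ∈ [0,1] write c_p(x) := p·a(x) + (1−p)·b(x), and define f(p) := exp(∫ log c_p(x) dμ(x))/e^r and h(p) := 1/(∫ 1/c_p(x) dμ(x)) (equal to 0 if the integral is +∞). Assume f(p) ≥ h(p) for every p ∈ [0,1], and let L ∈ ℝ satisfy f(p) ≤ L for every p ∈ [0,1]. Then the extended-real-valued function V_t(p,t,u) := ∫ (c_p(x) − u)/(c_p(x)·t − u·t + u) dμ(x) ∈ [−∞, +∞) (positive part always integrable) is both upper semicontinuous and lower semicontinuous on the compact set D̄ := {(p,t,u) ∈ ℝ³ : 0 ≤ p ≤ 1, 0 ≤ t ≤ 1, f(p) ≤ u ≤ L}. -/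
open MeasureTheory ENNReal

section Auxiliary

open Filter Topology Set

/-- Dominated convergence in `[0, ∞]`, where the dominating function is only needed when the
integral of the limit is finite: otherwise Fatou's lemma forces convergence to `∞`. -/
theorem tendsto_lintegral_of_dominated_of_ne_top {X ι : Type*} [MeasurableSpace X]
    {μ : Measure X} {l : Filter ι} [l.IsCountablyGenerated] {F : ι → X → ℝ≥0∞} {g : X → ℝ≥0∞}
    (hF : ∀ i, Measurable (F i)) (hlim : ∀ᵐ x ∂μ, Tendsto (fun i => F i x) l (𝓝 (g x)))
    (hdom : ∫⁻ x, g x ∂μ ≠ ⊤ →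
      ∃ K : X → ℝ≥0∞, ∫⁻ x, K x ∂μ ≠ ⊤ ∧ ∀ᶠ i in l, ∀ᵐ x ∂μ, F i x ≤ K x) :
    Tendsto (fun i => ∫⁻ x, F i x ∂μ) l (𝓝 (∫⁻ x, g x ∂μ)) := by
  by_cases hg : ∫⁻ x, g x ∂μ = ⊤
  · refine tendsto_of_seq_tendsto fun s hs => ?_
    rw [hg]
    refine tendsto_of_le_liminf_of_limsup_le ?_ le_top
    rw [← hg]
    calc ∫⁻ x, g x ∂μ = ∫⁻ x, liminf (fun n => F (s n) x) atTop ∂μ := by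
          refine lintegral_congr_ae ?_
          filter_upwards [hlim] with x hx
          exact (hx.comp hs).liminf_eq.symm
      _ ≤ liminf (fun n => ∫⁻ x, F (s n) x ∂μ) atTop := lintegral_liminf_le fun n => hF (s n)
  · obtain ⟨K, hK, hle⟩ := hdom hg
    exact tendsto_lintegral_filter_of_dominated_convergence K
      (Eventually.of_forall fun i => hF i) hle hK hlim

/-- The parameters `(p, t, u)` with `p, t ∈ [0, 1]` and `u > 0`. -/
def mixtureParams : Set (ℝ × ℝ × ℝ) :=
  {q | q.1 ∈ Icc (0 : ℝ) 1 ∧ q.2.1 ∈ Icc (0 : ℝ) 1 ∧ 0 < q.2.2}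

theorem eventually_half_le {w : ℝ × ℝ × ℝ → ℝ} (hw : Continuous w)
    (hw0 : ∀ q ∈ mixtureParams, 0 ≤ w q) {q₀ : ℝ × ℝ × ℝ} (hq₀ : q₀ ∈ mixtureParams) :
    ∀ᶠ q in 𝓝[mixtureParams] q₀, w q₀ / 2 ≤ w q := by
  rcases (hw0 q₀ hq₀).eq_or_lt with h | h
  · filter_upwards [self_mem_nhdsWithin] with q hq
    simpa [← h] using hw0 q hq
  · filter_upwards [nhdsWithin_le_nhds (hw.continuousAt.eventually (lt_mem_nhds (half_lt_self h)))]
      with q hq using hq.le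

theorem mixture_pos_s16 {p α β : ℝ} (hp : p ∈ Icc (0 : ℝ) 1) (hα : 0 < α) (hβ : 0 < β) :
    0 < p * α + (1 - p) * β := by
  rcases hp.1.eq_or_lt with rfl | h
  · simpa using hβ
  · have : 0 ≤ (1 - p) * β := mul_nonneg (sub_nonneg.2 hp.2) hβ.le
    positivity

theorem denom_pos {t u c : ℝ} (ht : t ∈ Icc (0 : ℝ) 1) (hc : 0 < c) (hu : 0 < u) :
    0 < c * t - u * t + u := by
  have := mixture_pos_s16 ht hc hu
  linarith

/-- The denominator is a combination of `a`, `b` and `1` with nonnegative continuous weights, so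
near `q₀` it is at least half its value at `q₀`, uniformly in the sample point. -/
theorem eventually_half_denom_le {q₀ : ℝ × ℝ × ℝ} (hq₀ : q₀ ∈ mixtureParams) :
    ∀ᶠ q in 𝓝[mixtureParams] q₀, ∀ α β : ℝ, 0 < α → 0 < β →
      ((q₀.1 * α + (1 - q₀.1) * β) * q₀.2.1 - q₀.2.2 * q₀.2.1 + q₀.2.2) / 2 ≤
        (q.1 * α + (1 - q.1) * β) * q.2.1 - q.2.2 * q.2.1 + q.2.2 := by
  have ha := eventually_half_le (w := fun q => q.1 * q.2.1) (by fun_prop)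
    (fun q hq => mul_nonneg hq.1.1 hq.2.1.1) hq₀
  have hb := eventually_half_le (w := fun q => (1 - q.1) * q.2.1) (by fun_prop)
    (fun q hq => mul_nonneg (sub_nonneg.2 hq.1.2) hq.2.1.1) hq₀
  have h1 := eventually_half_le (w := fun q => q.2.2 * (1 - q.2.1)) (by fun_prop)
    (fun q hq => mul_nonneg hq.2.2.le (sub_nonneg.2 hq.2.1.2)) hq₀
  filter_upwards [ha, hb, h1] with q ha hb h1 α β hα hβ
  have := mul_le_mul_of_nonneg_right ha hα.le
  have := mul_le_mul_of_nonneg_right hb hβ.le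
  linarith

theorem tendsto_ofReal_div_denom {v : ℝ × ℝ × ℝ → ℝ} (hv : Continuous v) {α β : ℝ}
    (hα : 0 < α) (hβ : 0 < β) {q₀ : ℝ × ℝ × ℝ} (hq₀ : q₀ ∈ mixtureParams) :
    Tendsto (fun q : ℝ × ℝ × ℝ => ENNReal.ofReal (v q) /
        ENNReal.ofReal ((q.1 * α + (1 - q.1) * β) * q.2.1 - q.2.2 * q.2.1 + q.2.2))
      (𝓝[mixtureParams] q₀) (𝓝 (ENNReal.ofReal (v q₀) /
        ENNReal.ofReal ((q₀.1 * α + (1 - q₀.1) * β) * q₀.2.1 - q₀.2.2 * q₀.2.1 + q₀.2.2))) := by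
  have hd := denom_pos hq₀.2.1 (mixture_pos_s16 hq₀.1 hα hβ) hq₀.2.2
  refine Tendsto.mono_left ?_ nhdsWithin_le_nhds
  have hc : Continuous fun q : ℝ × ℝ × ℝ =>
      (q.1 * α + (1 - q.1) * β) * q.2.1 - q.2.2 * q.2.1 + q.2.2 := by fun_prop
  exact ENNReal.Tendsto.div (ENNReal.tendsto_ofReal hv.continuousAt)
    (Or.inr (by simpa using hd)) (ENNReal.tendsto_ofReal hc.continuousAt)
    (Or.inl ENNReal.ofReal_ne_top)

theorem ofReal_sub_div_denom_le {t u c : ℝ} (ht : t ∈ Icc (0 : ℝ) 1) (hc : 0 < c) (hu : 0 < u) :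
    ENNReal.ofReal (c - u) / ENNReal.ofReal (c * t - u * t + u) ≤ ENNReal.ofReal (c / u) := by
  rcases le_total c u with h | h
  · simp [ENNReal.ofReal_of_nonpos (sub_nonpos.2 h)]
  · rw [← ENNReal.ofReal_div_of_pos (denom_pos ht hc hu)]
    have : 0 ≤ (c - u) * t := mul_nonneg (sub_nonneg.2 h) ht.1
    exact ENNReal.ofReal_le_ofReal (div_le_div₀ hc.le (by linarith) hu (by linarith))

/-- The negative part at `(t, u, c)` is controlled by the one at `(t₀, u₀, c₀)` as soon as the
denominators and the `u`-parameters are comparable. -/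
theorem ofReal_div_denom_le_of_half_le {t₀ u₀ c₀ u c d : ℝ} (ht₀ : t₀ ∈ Icc (0 : ℝ) 1)
    (hc₀ : 0 < c₀) (hu₀ : 0 < u₀) (hc : 0 < c) (hu : u ≤ 2 * u₀)
    (hd : (c₀ * t₀ - u₀ * t₀ + u₀) / 2 ≤ d) :
    ENNReal.ofReal (u - c) / ENNReal.ofReal d ≤
      4 * (1 + ENNReal.ofReal (u₀ - c₀) / ENNReal.ofReal (c₀ * t₀ - u₀ * t₀ + u₀)) := by
  have hd₀ := denom_pos ht₀ hc₀ hu₀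
  set d₀ := c₀ * t₀ - u₀ * t₀ + u₀ with hd₀_def
  have hm : u₀ ≤ d₀ + max (u₀ - c₀) 0 := by
    have h1 : (u₀ - c₀) * t₀ ≤ max (u₀ - c₀) 0 * t₀ :=
      mul_le_mul_of_nonneg_right (le_max_left _ _) ht₀.1
    have h2 : max (u₀ - c₀) 0 * t₀ ≤ max (u₀ - c₀) 0 :=
      mul_le_of_le_one_right (le_max_right _ _) ht₀.2
    linarith
  have hrhs : 4 * (1 + ENNReal.ofReal (u₀ - c₀) / ENNReal.ofReal d₀) =
      ENNReal.ofReal (4 * (1 + max (u₀ - c₀) 0 / d₀)) := by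
    rw [ENNReal.ofReal_mul (by norm_num), ENNReal.ofReal_add zero_le_one (by positivity),
      ENNReal.ofReal_div_of_pos hd₀]
    simp [ENNReal.ofReal_max]
  rw [hrhs, ← ENNReal.ofReal_div_of_pos (by linarith)]
  refine ENNReal.ofReal_le_ofReal ?_
  calc (u - c) / d ≤ (2 * u₀) / (d₀ / 2) := div_le_div₀ (by positivity) (by linarith)
        (by positivity) hd
    _ = 4 * (u₀ / d₀) := by field_simp; norm_num
    _ ≤ 4 * (1 + max (u₀ - c₀) 0 / d₀) := by
        gcongr
        rw [one_add_div hd₀.ne']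
        gcongr

section Mixture

variable {X : Type*} [MeasurableSpace X] {μ : Measure X} {a b : X → ℝ}

theorem lintegral_ofReal_sub_div_denom_ne_top (ha_pos : ∀ᵐ x ∂μ, 0 < a x)
    (hb_pos : ∀ᵐ x ∂μ, 0 < b x) (ha_int : Integrable a μ) (hb_int : Integrable b μ)
    {q : ℝ × ℝ × ℝ} (hq : q ∈ mixtureParams) :
    ∫⁻ x, ENNReal.ofReal ((q.1 * a x + (1 - q.1) * b x) - q.2.2) /
      ENNReal.ofReal ((q.1 * a x + (1 - q.1) * b x) * q.2.1 - q.2.2 * q.2.1 + q.2.2) ∂μ ≠ ⊤ := by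
  have hint : Integrable (fun x => (q.1 * a x + (1 - q.1) * b x) / q.2.2) μ :=
    ((ha_int.const_mul _).add (hb_int.const_mul _)).div_const _
  refine ne_top_of_le_ne_top hint.lintegral_lt_top.ne (lintegral_mono_ae ?_)
  filter_upwards [ha_pos, hb_pos] with x hα hβ
  exact ofReal_sub_div_denom_le hq.2.1 (mixture_pos_s16 hq.1 hα hβ) hq.2.2

theorem continuousWithinAt_lintegral_ofReal_sub_div_denom
    (ha_meas : Measurable a) (hb_meas : Measurable b)
    (ha_pos : ∀ᵐ x ∂μ, 0 < a x) (hb_pos : ∀ᵐ x ∂μ, 0 < b x)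
    (ha_int : Integrable a μ) (hb_int : Integrable b μ)
    {q₀ : ℝ × ℝ × ℝ} (hq₀ : q₀ ∈ mixtureParams) :
    ContinuousWithinAt (fun q : ℝ × ℝ × ℝ =>
      ∫⁻ x, ENNReal.ofReal ((q.1 * a x + (1 - q.1) * b x) - q.2.2) /
        ENNReal.ofReal ((q.1 * a x + (1 - q.1) * b x) * q.2.1 - q.2.2 * q.2.1 + q.2.2) ∂μ)
      mixtureParams q₀ := by
  refine tendsto_lintegral_of_dominated_of_ne_top (fun q => by fun_prop) ?_ fun _ =>
    ⟨fun x => ENNReal.ofReal ((a x + b x) / (q₀.2.2 / 2)),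
      ((ha_int.add hb_int).div_const _).lintegral_lt_top.ne, ?_⟩
  · filter_upwards [ha_pos, hb_pos] with x hα hβ
    exact tendsto_ofReal_div_denom
      (v := fun q => (q.1 * a x + (1 - q.1) * b x) - q.2.2) (by fun_prop) hα hβ hq₀
  · filter_upwards [self_mem_nhdsWithin, eventually_half_le (w := fun q => q.2.2) (by fun_prop)
      (fun q hq => hq.2.2.le) hq₀] with q hq hu
    filter_upwards [ha_pos, hb_pos] with x hα hβ
    refine (ofReal_sub_div_denom_le hq.2.1 (mixture_pos_s16 hq.1 hα hβ) hq.2.2).trans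
      (ENNReal.ofReal_le_ofReal (div_le_div₀ (by positivity) ?_ (half_pos hq₀.2.2) hu))
    have h1 := mul_le_of_le_one_left hα.le hq.1.2
    have h2 := mul_le_of_le_one_left hβ.le (sub_le_self 1 hq.1.1)
    linarith

theorem continuousWithinAt_lintegral_ofReal_sub_mixture_div_denom [IsFiniteMeasure μ]
    (ha_meas : Measurable a) (hb_meas : Measurable b)
    (ha_pos : ∀ᵐ x ∂μ, 0 < a x) (hb_pos : ∀ᵐ x ∂μ, 0 < b x)
    {q₀ : ℝ × ℝ × ℝ} (hq₀ : q₀ ∈ mixtureParams) :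
    ContinuousWithinAt (fun q : ℝ × ℝ × ℝ =>
      ∫⁻ x, ENNReal.ofReal (q.2.2 - (q.1 * a x + (1 - q.1) * b x)) /
        ENNReal.ofReal ((q.1 * a x + (1 - q.1) * b x) * q.2.1 - q.2.2 * q.2.1 + q.2.2) ∂μ)
      mixtureParams q₀ := by
  refine tendsto_lintegral_of_dominated_of_ne_top (fun q => by fun_prop) ?_ fun hN =>
    ⟨fun x => 4 * (1 + ENNReal.ofReal (q₀.2.2 - (q₀.1 * a x + (1 - q₀.1) * b x)) /
      ENNReal.ofReal ((q₀.1 * a x + (1 - q₀.1) * b x) * q₀.2.1 - q₀.2.2 * q₀.2.1 + q₀.2.2)),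
      ?_, ?_⟩
  · filter_upwards [ha_pos, hb_pos] with x hα hβ
    exact tendsto_ofReal_div_denom
      (v := fun q => q.2.2 - (q.1 * a x + (1 - q.1) * b x)) (by fun_prop) hα hβ hq₀
  · rw [lintegral_const_mul' _ _ (by norm_num), lintegral_add_left measurable_const]
    exact ENNReal.mul_ne_top (by norm_num) (ENNReal.add_ne_top.2 ⟨by simp, hN⟩)
  · have hu : ∀ᶠ q in 𝓝[mixtureParams] q₀, q.2.2 < 2 * q₀.2.2 :=
      nhdsWithin_le_nhds ((by fun_prop : Continuous fun q : ℝ × ℝ × ℝ => q.2.2).continuousAt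
        (gt_mem_nhds (by linarith [hq₀.2.2])))
    filter_upwards [self_mem_nhdsWithin, hu, eventually_half_denom_le hq₀] with q hq hu hd
    filter_upwards [ha_pos, hb_pos] with x hα hβ
    exact ofReal_div_denom_le_of_half_le hq₀.2.1 (mixture_pos_s16 hq₀.1 hα hβ) hq₀.2.2
      (mixture_pos_s16 hq.1 hα hβ) hu.le (hd _ _ hα hβ)

end Mixture

/-- Subtraction of a `[0, ∞]`-valued function from a finite one is continuous in `EReal`. -/
theorem ContinuousWithinAt.ereal_toReal_sub {Y : Type*} [TopologicalSpace Y] {P N : Y → ℝ≥0∞}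
    {s : Set Y} {y : Y} (hP : ContinuousWithinAt P s y) (hN : ContinuousWithinAt N s y)
    (hPy : P y ≠ ⊤) :
    ContinuousWithinAt (fun z => (((P z).toReal : ℝ) : EReal) - (N z : EReal)) s y := by
  have h1 : Tendsto (fun z => (((P z).toReal : ℝ) : EReal)) (𝓝[s] y)
      (𝓝 (((P y).toReal : ℝ) : EReal)) :=
    (continuous_coe_real_ereal.tendsto _).comp ((ENNReal.tendsto_toReal hPy).comp hP)
  have h2 : Tendsto (fun z => -(N z : EReal)) (𝓝[s] y) (𝓝 (-(N y : EReal))) :=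
    (continuous_neg.tendsto _).comp ((continuous_coe_ennreal_ereal.tendsto _).comp hN)
  have hadd : ContinuousAt (fun z : EReal × EReal => z.1 + z.2)
      ((((P y).toReal : ℝ) : EReal), -(N y : EReal)) :=
    EReal.continuousAt_add (Or.inl (EReal.coe_ne_top _)) (Or.inl (EReal.coe_ne_bot _))
  simp only [ContinuousWithinAt, sub_eq_add_neg]
  exact hadd.tendsto.comp (h1.prodMk_nhds h2)

end Auxiliary

/-- Lemma D.14 (main assertion): under the assumption `f(p) ≥ h(p)` on `[0,1]`
and `f ≤ L`, the `[−∞,∞)`-valued function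
`V_t(p,t,u) = ∫ (c_p − u)/(c_p·t − ut + u) dμ` (with `c_p = p·a + (1−p)·b`),
encoded in `EReal` as the difference of the finite positive part and the
(possibly infinite) negative part, is both upper and lower semicontinuous on
the compact set `D̄ = {(p,t,u) : 0 ≤ p ≤ 1, 0 ≤ t ≤ 1, f(p) ≤ u ≤ L}`;
moreover the positive part is finite on `D̄`. -/
theorem stmt16 {X : Type*} [MeasurableSpace X] (μ : Measure X) [IsProbabilityMeasure μ]
    (a b : X → ℝ) (ha_meas : Measurable a) (hb_meas : Measurable b)
    (ha_pos : ∀ᵐ x ∂μ, 0 < a x) (hb_pos : ∀ᵐ x ∂μ, 0 < b x)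
    (ha_int : Integrable a μ) (hb_int : Integrable b μ)
    (hloga : Integrable (fun x => Real.log (a x)) μ)
    (hlogb : Integrable (fun x => Real.log (b x)) μ)
    (r L : ℝ) (f h : ℝ → ℝ)
    (hf : ∀ p, f p = Real.exp (∫ x, Real.log (p * a x + (1 - p) * b x) ∂μ) / Real.exp r)
    (hh : ∀ p, h p =
      ((∫⁻ x, ENNReal.ofReal (1 / (p * a x + (1 - p) * b x)) ∂μ)⁻¹).toReal)
    (hfh : ∀ p ∈ Set.Icc (0 : ℝ) 1, h p ≤ f p)
    (hL : ∀ p ∈ Set.Icc (0 : ℝ) 1, f p ≤ L)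
    (Vt : ℝ × ℝ × ℝ → EReal)
    (hVt : ∀ q : ℝ × ℝ × ℝ, Vt q =
      (((∫⁻ x, ENNReal.ofReal ((q.1 * a x + (1 - q.1) * b x) - q.2.2) /
          ENNReal.ofReal ((q.1 * a x + (1 - q.1) * b x) * q.2.1 - q.2.2 * q.2.1 + q.2.2)
          ∂μ).toReal : EReal) -
       ((∫⁻ x, ENNReal.ofReal (q.2.2 - (q.1 * a x + (1 - q.1) * b x)) /
          ENNReal.ofReal ((q.1 * a x + (1 - q.1) * b x) * q.2.1 - q.2.2 * q.2.1 + q.2.2)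
          ∂μ : ℝ≥0∞) : EReal))) :
    (∀ q ∈ {q : ℝ × ℝ × ℝ | q.1 ∈ Set.Icc (0 : ℝ) 1 ∧ q.2.1 ∈ Set.Icc (0 : ℝ) 1 ∧
        f q.1 ≤ q.2.2 ∧ q.2.2 ≤ L},
      (∫⁻ x, ENNReal.ofReal ((q.1 * a x + (1 - q.1) * b x) - q.2.2) /
        ENNReal.ofReal ((q.1 * a x + (1 - q.1) * b x) * q.2.1 - q.2.2 * q.2.1 + q.2.2)
        ∂μ) ≠ ⊤) ∧
    UpperSemicontinuousOn Vt
      {q : ℝ × ℝ × ℝ | q.1 ∈ Set.Icc (0 : ℝ) 1 ∧ q.2.1 ∈ Set.Icc (0 : ℝ) 1 ∧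
        f q.1 ≤ q.2.2 ∧ q.2.2 ≤ L} ∧
    LowerSemicontinuousOn Vt
      {q : ℝ × ℝ × ℝ | q.1 ∈ Set.Icc (0 : ℝ) 1 ∧ q.2.1 ∈ Set.Icc (0 : ℝ) 1 ∧
        f q.1 ≤ q.2.2 ∧ q.2.2 ≤ L} := by
  set D : Set (ℝ × ℝ × ℝ) := {q | q.1 ∈ Set.Icc (0 : ℝ) 1 ∧ q.2.1 ∈ Set.Icc (0 : ℝ) 1 ∧
    f q.1 ≤ q.2.2 ∧ q.2.2 ≤ L}
  have hD : D ⊆ mixtureParams := fun q hq =>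
    ⟨hq.1, hq.2.1, lt_of_lt_of_le (by rw [hf]; positivity) hq.2.2.1⟩
  have hfin : ∀ q ∈ D, _ := fun q hq =>
    lintegral_ofReal_sub_div_denom_ne_top ha_pos hb_pos ha_int hb_int (hD hq)
  have hcont : ContinuousOn Vt D := fun q hq => by
    rw [funext hVt]
    exact ((continuousWithinAt_lintegral_ofReal_sub_div_denom ha_meas hb_meas ha_pos hb_pos
      ha_int hb_int (hD hq)).mono hD).ereal_toReal_sub
      ((continuousWithinAt_lintegral_ofReal_sub_mixture_div_denom ha_meas hb_meas ha_pos hb_pos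
        (hD hq)).mono hD) (hfin q hq)
  exact ⟨hfin, hcont.upperSemicontinuousOn, hcont.lowerSemicontinuousOn⟩
end
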